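/- Assume Condition (P). Then for any ξ ∈ [0,1] and λ ∈ [0,1) there exists a constant c_* < ∞ such that for all sequences (P_k)_{k≥1} ⊂ 𝓟, all measurable f : X → ℝ with ‖f‖_{V̂^{α_{λ,ξ}}} = sup_{x∈X} |f(x)|/V̂^{α_{λ,ξ}}(x) < ∞ where α_{λ,ξ} = α(1−λ)(1−ξ), and all x, x' ∈ X: Σ_{n=0}^∞ (n+1)^{α(1−λ)ξ/(1−α)} |P^(n) f(x) − P^(n) f(x')| ≤ c_* · ‖f‖_{V̂^{α_{λ,ξ}}} · (V̂^{1−λα}(x) + V̂^{1−λα}(x') − 1). -/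

import Mathlib

open MeasureTheory ProbabilityTheory Filter Set

noncomputable def iterKernel {X : Type*} [MeasurableSpace X]
    (P : ℕ → Kernel X X) : ℕ → Kernel X X
  | 0 => Kernel.id
  | n + 1 => (P (n + 1)).comp (iterKernel P n)

noncomputable def Hfun (φ : ℝ → ℝ) (t : ℝ) : ℝ := ∫ s in (1:ℝ)..t, (φ s)⁻¹

noncomputable def Hinv (φ : ℝ → ℝ) : ℝ → ℝ := Function.invFunOn (Hfun φ) (Set.Ici 1)

noncomputable def rate (φ : ℝ → ℝ) (εb : ℝ) (n : ℕ) : ℝ := φ (Hinv φ (εb * n)) / φ 1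

noncomputable def deltaSeq (φ : ℝ → ℝ) (εb : ℝ) (k : ℕ) : ℝ := εb * deriv φ (Hinv φ (εb * k))

noncomputable def bbar (φ : ℝ → ℝ) (εb bV : ℝ) : ℝ := 2 * bV + εb * φ 1

noncomputable def Mone (φ : ℝ → ℝ) (εb εν bV cV : ℝ) : ℝ :=
  rate φ εb 1 * (1 + 2 * rate φ εb 1 / (εb * φ 1) * ((bV + cV) / (1 - εν) - 1))

noncomputable def cstar (φ : ℝ → ℝ) (εb εν bV cV : ℝ) : ℝ :=
  ∑' j : ℕ, (1 - εν) ^ j * ∏ k ∈ Finset.Icc 1 j, (1 + deltaSeq φ εb k * Mone φ εb εν bV cV)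

noncomputable def cconst (φ : ℝ → ℝ) (εb εν bV cV : ℝ) : ℝ :=
  2 / (εb * φ 1) * (2 + bbar φ εb bV / εν +
    cstar φ εb εν bV cV * bbar φ εb bV * rate φ εb 1 * (1 + rate φ εb 1 / (εb * φ 1)))

noncomputable def Qmeas {X : Type*} [MeasurableSpace X]
    (P : ℕ → Kernel X X) (ν : ℕ → Measure X) (εν : ℝ) (k : ℕ) (x : X) : Measure X :=
  (ENNReal.ofReal (1 - εν))⁻¹ • (P k x - ENNReal.ofReal εν • ν k)

theorem rpow_le_tangent {η x y : ℝ} (hη0 : 0 ≤ η) (hη1 : η ≤ 1) (hx : 0 < x) (hy : 0 ≤ y) :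
    y ^ η ≤ x ^ η + η * x ^ (η - 1) * (y - x) := by
  have hs : -1 ≤ (y - x) / x := by
    rw [le_div_iff₀ hx]
    linarith
  have h := rpow_one_add_le_one_add_mul_self hs hη0 hη1
  have hyx : 1 + (y - x) / x = y / x := by
    field_simp
    ring
  rw [hyx, Real.div_rpow hy hx.le, div_le_iff₀ (Real.rpow_pos_of_pos hx η)] at h
  rw [Real.rpow_sub_one hx.ne']
  calc y ^ η ≤ (1 + η * ((y - x) / x)) * x ^ η := h
    _ = x ^ η + η * (x ^ η / x) * (y - x) := by ring

theorem add_rpow_rpow_inv_le_tangent {q a u u₀ : ℝ} (hq0 : 0 < q) (hq1 : q ≤ 1) (ha : 0 ≤ a)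
    (hu : 0 ≤ u) (hu₀ : 0 < u₀) :
    (a + u ^ q) ^ q⁻¹ ≤
      (a + u₀ ^ q) ^ q⁻¹ + (a + u₀ ^ q) ^ (q⁻¹ - 1) * u₀ ^ (q - 1) * (u - u₀) := by
  have hw : 0 < u₀ ^ q := Real.rpow_pos_of_pos hu₀ q
  obtain ⟨S, hS⟩ : ∃ S, S = a + u₀ ^ q := ⟨_, rfl⟩
  have hS0 : 0 < S := by linarith
  have hconc := (Real.concaveOn_rpow hq0.le hq1).2 (Set.mem_Ici.2 zero_le_one)
    (Set.mem_Ici.2 (div_nonneg hu hu₀.le)) (div_nonneg ha hS0.le) (div_nonneg hw.le hS0.le)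
    (by rw [← add_div, ← hS, div_self hS0.ne'])
  simp only [smul_eq_mul, Real.one_rpow, mul_one] at hconc
  rw [Real.div_rpow hu hu₀.le] at hconc
  have hmono := Real.rpow_le_rpow (by positivity) hconc (inv_nonneg.2 hq0.le)
  rw [Real.rpow_rpow_inv (by positivity) hq0.ne'] at hmono
  have hleft : a / S + u₀ ^ q / S * (u ^ q / u₀ ^ q) = (a + u ^ q) / S := by
    field_simp
  rw [hleft, Real.div_rpow (by positivity) hS0.le, div_le_iff₀ (by positivity)] at hmono
  rw [← hS, Real.rpow_sub_one hS0.ne', Real.rpow_sub_one hu₀.ne']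
  refine hmono.trans_eq ?_
  have haS : a = S - u₀ ^ q := by linarith
  rw [haS]
  field_simp
  ring

theorem rpow_add_sub_le {p γ S : ℝ} (hp : 1 ≤ p) (hγ : 0 ≤ γ) (hS : 0 < S) :
    (S + γ / (2 * p)) ^ p - γ * (S + γ / (2 * p)) ^ (p - 1) ≤ S ^ p - γ / 2 * S ^ (p - 1) := by
  have hp0 : 0 < p := by linarith
  obtain ⟨c, hc⟩ : ∃ c, c = γ / (2 * p) := ⟨_, rfl⟩
  have hc0 : 0 ≤ c := by rw [hc]; positivity
  have hpc : p * c = γ / 2 := by rw [hc]; field_simp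
  rw [← hc]
  have hT : 0 < S + c := by linarith
  have hs : -1 ≤ -c / (S + c) := by
    rw [le_div_iff₀ hT]
    linarith
  have h := one_add_mul_self_le_rpow_one_add hs hp
  have h1 : 1 + -c / (S + c) = S / (S + c) := by
    field_simp
    ring
  rw [h1, Real.div_rpow hS.le hT.le, le_div_iff₀ (by positivity)] at h
  have h2 : (S + c) ^ (p - 1) = (S + c) ^ p / (S + c) := Real.rpow_sub_one hT.ne' p
  have h3 : (1 + p * (-c / (S + c))) * (S + c) ^ p = (S + c) ^ p - γ / 2 * (S + c) ^ (p - 1) := by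
    rw [h2, ← hpc]
    ring
  have h4 : S ^ (p - 1) ≤ (S + c) ^ (p - 1) :=
    Real.rpow_le_rpow hS.le (by linarith) (by linarith)
  nlinarith

theorem eventually_mul_rpow_add_le {p δ L ε : ℝ} (hε : 0 < ε) :
    ∀ᶠ S : ℝ in atTop, (1 - ε) * (S + L) ^ p ≤ S ^ p - δ * S ^ (p - 1) := by
  have hlim : Tendsto (fun S : ℝ => (1 - ε) * (1 + L / S) ^ p + δ / S) atTop
      (nhds ((1 - ε) * (1 + 0) ^ p + 0)) := by
    have hL : Tendsto (fun S : ℝ => L / S) atTop (nhds 0) := tendsto_const_nhds.div_atTop tendsto_id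
    have hδ : Tendsto (fun S : ℝ => δ / S) atTop (nhds 0) := tendsto_const_nhds.div_atTop tendsto_id
    exact (((hL.const_add 1).rpow_const (Or.inl (by norm_num))).const_mul _).add hδ
  have hlt : (1 - ε) * (1 + 0 : ℝ) ^ p + 0 < 1 := by simp [hε]
  filter_upwards [hlim.eventually_lt_const hlt, eventually_gt_atTop 0,
    eventually_ge_atTop (-L)] with S h1 hS hSL
  have h2 : 1 + L / S = (S + L) / S := by field_simp
  rw [h2, Real.div_rpow (by linarith) hS.le] at h1
  have hSp : 0 < S ^ p := Real.rpow_pos_of_pos hS p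
  rw [Real.rpow_sub_one hS.ne']
  have h3 := mul_le_mul_of_nonneg_right h1.le hSp.le
  have h4 : ((1 - ε) * ((S + L) ^ p / S ^ p) + δ / S) * S ^ p
      = (1 - ε) * (S + L) ^ p + δ * (S ^ p / S) := by
    field_simp
  linarith

/-- A finite measure on pairs whose marginals are `μ` and `μ'` with a common part `θ` removed. -/
structure IsUncoupling {X : Type*} [MeasurableSpace X] (Q : Measure (X × X)) (θ μ μ' : Measure X) :
    Prop where
  fst_add : Q.map Prod.fst + θ = μ
  snd_add : Q.map Prod.snd + θ = μ'

theorem exists_uncoupled_measure {X : Type*} [MeasurableSpace X] {μ μ' ν : Measure X}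
    [IsProbabilityMeasure μ] [IsProbabilityMeasure μ'] [IsProbabilityMeasure ν] {ε : ℝ}
    (hε0 : 0 ≤ ε) (hε1 : ε < 1) (hμ : ENNReal.ofReal ε • ν ≤ μ) (hμ' : ENNReal.ofReal ε • ν ≤ μ') :
    ∃ Q : Measure (X × X), IsFiniteMeasure Q ∧ Q.real univ = 1 - ε ∧
      IsUncoupling Q (ENNReal.ofReal ε • ν) μ μ' := by
  have hfin : IsFiniteMeasure (ENNReal.ofReal ε • ν) := Measure.smul_finite ν ENNReal.ofReal_ne_top
  have hadd := Measure.sub_add_cancel_of_le hμ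
  have hadd' := Measure.sub_add_cancel_of_le hμ'
  obtain ⟨ρ, hρ⟩ : ∃ ρ, ρ = μ - ENNReal.ofReal ε • ν := ⟨_, rfl⟩
  obtain ⟨ρ', hρ'⟩ : ∃ ρ', ρ' = μ' - ENNReal.ofReal ε • ν := ⟨_, rfl⟩
  have hρfin : IsFiniteMeasure ρ := by rw [hρ]; infer_instance
  have hρfin' : IsFiniteMeasure ρ' := by rw [hρ']; infer_instance
  rw [← hρ] at hadd
  rw [← hρ'] at hadd'
  have mass : ∀ {σ τ : Measure X} [IsProbabilityMeasure τ],
      σ + ENNReal.ofReal ε • ν = τ → σ univ = ENNReal.ofReal (1 - ε) := by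
    intro σ τ _ h
    have h1 : σ univ + ENNReal.ofReal ε = 1 := by
      have := congrArg (fun m : Measure X => m univ) h
      simpa using this
    rw [ENNReal.ofReal_sub _ hε0, ENNReal.ofReal_one, ← h1,
      ENNReal.add_sub_cancel_right ENNReal.ofReal_ne_top]
  have hm := mass hadd
  have hm' := mass hadd'
  have hne : ENNReal.ofReal (1 - ε) ≠ 0 := by simpa using hε1
  have hcancel : (ENNReal.ofReal (1 - ε))⁻¹ * ENNReal.ofReal (1 - ε) = 1 :=
    ENNReal.inv_mul_cancel hne ENNReal.ofReal_ne_top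
  refine ⟨(ENNReal.ofReal (1 - ε))⁻¹ • ρ.prod ρ', ?_, ?_, ?_, ?_⟩
  · exact Measure.smul_finite _ (ENNReal.inv_ne_top.2 hne)
  · rw [Measure.real, Measure.smul_apply, smul_eq_mul, ← Set.univ_prod_univ, Measure.prod_prod, hm,
      hm', ← mul_assoc, hcancel, one_mul, ENNReal.toReal_ofReal (by linarith)]
  · rw [Measure.map_smul, Measure.map_fst_prod, hm', smul_smul, hcancel, one_smul, hadd]
  · rw [Measure.map_smul, Measure.map_snd_prod, hm, smul_smul, hcancel, one_smul, hadd']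

namespace IsUncoupling

variable {X : Type*} [MeasurableSpace X] {Q : Measure (X × X)} {θ μ μ' : Measure X}

theorem integrable_fst (h : IsUncoupling Q θ μ μ') {f : X → ℝ} (hf : Integrable f μ) :
    Integrable (fun z : X × X => f z.1) Q := by
  rw [← h.fst_add] at hf
  exact hf.left_of_add_measure.comp_measurable measurable_fst

theorem integrable_snd (h : IsUncoupling Q θ μ μ') {f : X → ℝ} (hf : Integrable f μ') :
    Integrable (fun z : X × X => f z.2) Q := by
  rw [← h.snd_add] at hf
  exact hf.left_of_add_measure.comp_measurable measurable_snd

theorem integral_fst (h : IsUncoupling Q θ μ μ') {f : X → ℝ} (hf : Integrable f μ) :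
    ∫ z, f z.1 ∂Q = ∫ x, f x ∂μ - ∫ x, f x ∂θ := by
  rw [← h.fst_add] at hf ⊢
  rw [integral_add_measure hf.left_of_add_measure hf.right_of_add_measure,
    integral_map measurable_fst.aemeasurable hf.left_of_add_measure.aestronglyMeasurable]
  ring

theorem integral_snd (h : IsUncoupling Q θ μ μ') {f : X → ℝ} (hf : Integrable f μ') :
    ∫ z, f z.2 ∂Q = ∫ x, f x ∂μ' - ∫ x, f x ∂θ := by
  rw [← h.snd_add] at hf ⊢
  rw [integral_add_measure hf.left_of_add_measure hf.right_of_add_measure,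
    integral_map measurable_snd.aemeasurable hf.left_of_add_measure.aestronglyMeasurable]
  ring

theorem integral_sub (h : IsUncoupling Q θ μ μ') {f : X → ℝ} (hf : Integrable f μ)
    (hf' : Integrable f μ') : ∫ z, (f z.1 - f z.2) ∂Q = ∫ x, f x ∂μ - ∫ x, f x ∂μ' := by
  rw [MeasureTheory.integral_sub (h.integrable_fst hf) (h.integrable_snd hf'), h.integral_fst hf,
    h.integral_snd hf']
  ring

theorem integral_add_le (h : IsUncoupling Q θ μ μ') {f : X → ℝ} (hf0 : ∀ x, 0 ≤ f x)
    (hf : Integrable f μ) (hf' : Integrable f μ') :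
    ∫ z, (f z.1 + f z.2) ∂Q ≤ ∫ x, f x ∂μ + ∫ x, f x ∂μ' := by
  rw [MeasureTheory.integral_add (h.integrable_fst hf) (h.integrable_snd hf'), h.integral_fst hf,
    h.integral_snd hf']
  have hθ : 0 ≤ ∫ x, f x ∂θ := integral_nonneg hf0
  linarith

end IsUncoupling

theorem integrable_add_rpow_rpow_inv {Y : Type*} [MeasurableSpace Y] {Q : Measure Y}
    [IsFiniteMeasure Q] {U : Y → ℝ} (hU : Measurable U) (hU0 : ∀ z, 0 ≤ U z) (hUi : Integrable U Q)
    {q a : ℝ} (hq0 : 0 < q) (hq1 : q ≤ 1) (ha : 0 ≤ a) :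
    Integrable (fun z => (a + U z ^ q) ^ q⁻¹) Q := by
  have hdom : Integrable (fun z => (a + (1 : ℝ) ^ q) ^ q⁻¹ +
      (a + (1 : ℝ) ^ q) ^ (q⁻¹ - 1) * (1 : ℝ) ^ (q - 1) * (U z - 1)) Q :=
    (integrable_const _).add ((hUi.sub (integrable_const _)).const_mul _)
  refine hdom.mono' (((hU.pow_const q).const_add a).pow_const q⁻¹).aestronglyMeasurable (Eventually.of_forall fun z => ?_)
  have hz := Real.rpow_nonneg (hU0 z) q
  rw [Real.norm_of_nonneg (by positivity)]
  exact add_rpow_rpow_inv_le_tangent hq0 hq1 ha (hU0 z) one_pos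

theorem integral_add_rpow_rpow_inv_le {Y : Type*} [MeasurableSpace Y] {Q : Measure Y}
    [IsFiniteMeasure Q] {U : Y → ℝ} (hU : Measurable U) (hU0 : ∀ z, 0 ≤ U z) (hUi : Integrable U Q)
    {q a u₀ : ℝ} (hq0 : 0 < q) (hq1 : q ≤ 1) (ha : 0 ≤ a) (hu₀ : 0 < u₀) :
    ∫ z, (a + U z ^ q) ^ q⁻¹ ∂Q ≤ Q.real univ * (a + u₀ ^ q) ^ q⁻¹ +
      (a + u₀ ^ q) ^ (q⁻¹ - 1) * u₀ ^ (q - 1) * (∫ z, U z ∂Q - Q.real univ * u₀) := by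
  have hsub : Integrable (fun z => U z - u₀) Q := hUi.sub (integrable_const _)
  have hlin : Integrable (fun z => (a + u₀ ^ q) ^ (q⁻¹ - 1) * u₀ ^ (q - 1) * (U z - u₀)) Q :=
    hsub.const_mul _
  calc ∫ z, (a + U z ^ q) ^ q⁻¹ ∂Q
      ≤ ∫ z, ((a + u₀ ^ q) ^ q⁻¹ +
          (a + u₀ ^ q) ^ (q⁻¹ - 1) * u₀ ^ (q - 1) * (U z - u₀)) ∂Q :=
        integral_mono (integrable_add_rpow_rpow_inv hU hU0 hUi hq0 hq1 ha)
          ((integrable_const _).add hlin)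
          fun z => add_rpow_rpow_inv_le_tangent hq0 hq1 ha (hU0 z) hu₀
    _ = _ := by
        rw [integral_add (integrable_const _) hlin, integral_const_mul,
          integral_sub hUi (integrable_const _), integral_const, integral_const]
        simp only [smul_eq_mul]

theorem exists_pair_drift {X : Type*} [MeasurableSpace X] {PP : Set (Kernel X X)}
    (hPP : ∀ P ∈ PP, IsMarkovKernel P) {V : X → ℝ} (hV : Measurable V) (hV1 : ∀ x, 1 ≤ V x)
    {α β b : ℝ} (hα : α ∈ Set.Ioo (0 : ℝ) 1) (hβ : 0 < β) (hb : 0 ≤ b)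
    (hint : ∀ P ∈ PP, ∀ x, Integrable V (P x))
    (hdrift : ∀ P ∈ PP, ∀ x, ∫ y, V y ∂(P x) ≤ V x - β * V x ^ α + b)
    (hsmall : ∀ v : ℝ, ∃ ε : ℝ, 0 < ε ∧ ∃ ν : Kernel X X → Measure X,
      (∀ P ∈ PP, IsProbabilityMeasure (ν P)) ∧
      ∀ P ∈ PP, ∀ x : X, V x ≤ v → ∀ A : Set X, MeasurableSet A →
        ENNReal.ofReal ε * ν P A ≤ P x A) :
    ∃ c a₀ δ : ℝ, 0 < c ∧ c ≤ a₀ ∧ 0 < δ ∧ ∀ P ∈ PP, ∀ x x' : X,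
      ∃ (Q : Measure (X × X)) (θ : Measure X), IsFiniteMeasure Q ∧ IsUncoupling Q θ (P x) (P x') ∧
        ∀ a, a₀ ≤ a → ∫ z, (a + c + (V z.1 + V z.2) ^ (1 - α)) ^ (1 - α)⁻¹ ∂Q ≤
          (a + (V x + V x') ^ (1 - α)) ^ (1 - α)⁻¹ -
            δ * (a + (V x + V x') ^ (1 - α)) ^ ((1 - α)⁻¹ - 1) := by
  obtain ⟨hα0, hα1⟩ := hα
  obtain ⟨q, hq⟩ : ∃ q, q = 1 - α := ⟨_, rfl⟩
  rw [← hq]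
  have hq0 : 0 < q := by linarith
  have hq1 : q ≤ 1 := by linarith
  have hp1 : 1 ≤ q⁻¹ := (one_le_inv₀ hq0).2 hq1
  have hV0 : ∀ x, 0 ≤ V x := fun x => by linarith [hV1 x]
  have hU : Measurable fun z : X × X => V z.1 + V z.2 := by fun_prop
  have hU0 : ∀ z : X × X, 0 ≤ V z.1 + V z.2 := fun z => add_nonneg (hV0 _) (hV0 _)
  obtain ⟨γ, hγ⟩ : ∃ γ, γ = β / 2 := ⟨_, rfl⟩
  have hγ0 : 0 < γ := by linarith
  obtain ⟨c, hc⟩ : ∃ c, c = γ / (2 * q⁻¹) := ⟨_, rfl⟩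
  have hc0 : 0 < c := by rw [hc]; positivity
  obtain ⟨v, hv⟩ : ∃ v, v = (4 * b / β) ^ α⁻¹ := ⟨_, rfl⟩
  have hv0 : 0 ≤ v := by rw [hv]; positivity
  have hvα : v ^ α = 4 * b / β := by rw [hv, Real.rpow_inv_rpow (by positivity) hα0.ne']
  obtain ⟨ε', hε'0, ν, hν, hminor'⟩ := hsmall v
  obtain ⟨ε, hε⟩ : ∃ ε, ε = min ε' (1 / 2) := ⟨_, rfl⟩
  have hε0 : 0 < ε := by rw [hε]; positivity
  have hε2 : ε ≤ 1 / 2 := by rw [hε]; exact min_le_right _ _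
  have hminor : ∀ P ∈ PP, ∀ x, V x ≤ v → ENNReal.ofReal ε • ν P ≤ P x := by
    intro P hP x hx
    refine Measure.le_iff.2 fun A hA => le_trans ?_ (hminor' P hP x hx A hA)
    rw [Measure.smul_apply, smul_eq_mul]
    gcongr
    rw [hε]
    exact min_le_left _ _
  obtain ⟨u₀, hu₀⟩ : ∃ u₀, u₀ = 2 * (v + 2 * b + 1) := ⟨_, rfl⟩
  have hu₀0 : 0 < u₀ := by rw [hu₀]; positivity
  obtain ⟨a₁, ha₁⟩ := eventually_atTop.1
    (eventually_mul_rpow_add_le (p := q⁻¹) (δ := γ / 2) (L := c + u₀ ^ q) hε0)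
  refine ⟨c, max a₁ c, γ / 2, hc0, le_max_right _ _, by linarith, fun P hP x x' => ?_⟩
  have := hPP P hP
  have := hν P hP
  obtain ⟨u, hu⟩ : ∃ u, u = V x + V x' := ⟨_, rfl⟩
  have hx1 := hV1 x
  have hx1' := hV1 x'
  have hu0 : 0 < u := by linarith
  have hsum : ∫ y, V y ∂(P x) + ∫ y, V y ∂(P x') ≤ u - β * u ^ α + 2 * b := by
    have h1 := hdrift P hP x
    have h2 := hdrift P hP x'
    have h3 := Real.rpow_add_le_add_rpow (hV0 x) (hV0 x') hα0.le hα1.le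
    rw [← hu] at h3
    have h4 := mul_le_mul_of_nonneg_left h3 hβ.le
    linarith
  rw [← hu]
  have huq : 0 < u ^ q := Real.rpow_pos_of_pos hu0 q
  by_cases huv : u ≤ v
  · obtain ⟨Q, hQfin, hQmass, hQ⟩ := exists_uncoupled_measure hε0.le (by linarith : ε < 1)
      (hminor P hP x (by linarith)) (hminor P hP x' (by linarith))
    refine ⟨Q, _, hQfin, hQ, fun a ha => ?_⟩
    have haa₁ : a₁ ≤ a := (le_max_left _ _).trans ha
    have hca : c ≤ a := (le_max_right _ _).trans ha
    have hUi : Integrable (fun z : X × X => V z.1 + V z.2) Q :=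
      (hQ.integrable_fst (hint P hP x)).add (hQ.integrable_snd (hint P hP x'))
    have hUle := hQ.integral_add_le hV0 (hint P hP x) (hint P hP x')
    have hmain := integral_add_rpow_rpow_inv_le hU hU0 hUi hq0 hq1 (by linarith : 0 ≤ a + c) hu₀0
    rw [hQmass] at hmain
    have huα : 0 ≤ β * u ^ α := by positivity
    have hneg : ∫ z : X × X, (V z.1 + V z.2) ∂Q - (1 - ε) * u₀ ≤ 0 := by
      have : 1 / 2 * u₀ ≤ (1 - ε) * u₀ := by gcongr; linarith
      linarith
    have hcoef : 0 ≤ (a + c + u₀ ^ q) ^ (q⁻¹ - 1) * u₀ ^ (q - 1) := by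
      have : 0 ≤ a := by linarith
      positivity
    have hfirst := add_le_of_nonpos_right (a := (1 - ε) * (a + c + u₀ ^ q) ^ q⁻¹)
      (mul_nonpos_of_nonneg_of_nonpos hcoef hneg)
    refine hmain.trans (hfirst.trans (le_trans ?_ (ha₁ (a + u ^ q) (by linarith))))
    have h0 : 0 ≤ a + c + u₀ ^ q := by
      have : 0 ≤ a := by linarith
      positivity
    refine mul_le_mul_of_nonneg_left (Real.rpow_le_rpow h0 (by linarith) (by linarith)) ?_
    linarith
  · have huv' : v ≤ u := (not_le.1 huv).le
    obtain ⟨Q, hQfin, hQmass, hQ⟩ := exists_uncoupled_measure (μ := P x) (μ' := P x') (ν := P x)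
      le_rfl zero_lt_one (by simp [Measure.zero_le]) (by simp [Measure.zero_le])
    refine ⟨Q, _, hQfin, hQ, fun a ha => ?_⟩
    have hca : c ≤ a := (le_max_right _ _).trans ha
    have hUi : Integrable (fun z : X × X => V z.1 + V z.2) Q :=
      (hQ.integrable_fst (hint P hP x)).add (hQ.integrable_snd (hint P hP x'))
    have hUle := hQ.integral_add_le hV0 (hint P hP x) (hint P hP x')
    have hmain := integral_add_rpow_rpow_inv_le hU hU0 hUi hq0 hq1 (by linarith : 0 ≤ a + c) hu0
    rw [hQmass, sub_zero, one_mul, one_mul] at hmain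
    have hdec : ∫ z : X × X, (V z.1 + V z.2) ∂Q - u ≤ -(γ * u ^ α) := by
      have h1 : 4 * b / β ≤ u ^ α := by
        rw [← hvα]
        exact Real.rpow_le_rpow hv0 huv' hα0.le
      rw [div_le_iff₀ hβ] at h1
      rw [hγ]
      linarith
    have hST : a + c + u ^ q = a + u ^ q + γ / (2 * q⁻¹) := by rw [hc]; ring
    have hS0 : 0 < a + u ^ q := by linarith
    have hT0 : 0 ≤ a + c + u ^ q := by linarith
    have hcoef : 0 ≤ (a + c + u ^ q) ^ (q⁻¹ - 1) * u ^ (q - 1) := by positivity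
    have huu : u ^ (q - 1) * u ^ α = 1 := by
      rw [← Real.rpow_add hu0, hq]
      simp
    have hstep := mul_le_mul_of_nonneg_left hdec hcoef
    have hfin := rpow_add_sub_le hp1 hγ0.le hS0
    rw [← hST] at hfin
    calc _ ≤ _ := hmain
      _ ≤ (a + c + u ^ q) ^ q⁻¹ - γ * (a + c + u ^ q) ^ (q⁻¹ - 1) * (u ^ (q - 1) * u ^ α) := by
        linarith
      _ ≤ _ := by rwa [huu, mul_one]

theorem iterKernel_succ_eq_comp {X : Type*} [MeasurableSpace X] (P : ℕ → Kernel X X) (n : ℕ) :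
    iterKernel P (n + 1) = (iterKernel (fun k => P (k + 1)) n).comp (P 1) := by
  induction n with
  | zero => simp [iterKernel]
  | succ n ih =>
    rw [iterKernel, ih, iterKernel, Kernel.comp_assoc]

theorem lintegral_iterKernel_le {X : Type*} [MeasurableSpace X] {PP : Set (Kernel X X)}
    {V : X → ENNReal} (hV : Measurable V) {B : ENNReal}
    (hgrow : ∀ P ∈ PP, ∀ x, ∫⁻ y, V y ∂(P x) ≤ B * V x) {P : ℕ → Kernel X X}
    (hP : ∀ k, 1 ≤ k → P k ∈ PP) (n : ℕ) (x : X) :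
    ∫⁻ y, V y ∂(iterKernel P n x) ≤ B ^ n * V x := by
  induction n with
  | zero => simp [iterKernel, Kernel.id_apply, lintegral_dirac' x hV]
  | succ n ih =>
    rw [iterKernel, Kernel.lintegral_comp _ _ _ hV]
    calc ∫⁻ y, ∫⁻ z, V z ∂(P (n + 1) y) ∂(iterKernel P n x)
        ≤ ∫⁻ y, B * V y ∂(iterKernel P n x) :=
          lintegral_mono fun y => hgrow _ (hP _ n.succ_pos) y
      _ = B * ∫⁻ y, V y ∂(iterKernel P n x) := lintegral_const_mul _ hV
      _ ≤ B * (B ^ n * V x) := by gcongr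
      _ = B ^ (n + 1) * V x := by ring

theorem integrable_iterKernel {X : Type*} [MeasurableSpace X] {PP : Set (Kernel X X)}
    {V : X → ℝ} (hV : Measurable V) (hV0 : ∀ x, 0 ≤ V x) {B : ℝ} (hB : 0 ≤ B)
    (hint : ∀ P ∈ PP, ∀ x, Integrable V (P x))
    (hgrow : ∀ P ∈ PP, ∀ x, ∫ y, V y ∂(P x) ≤ B * V x) {P : ℕ → Kernel X X}
    (hP : ∀ k, 1 ≤ k → P k ∈ PP) (n : ℕ) (x : X) :
    Integrable V (iterKernel P n x) ∧ ∫ y, V y ∂(iterKernel P n x) ≤ B ^ n * V x := by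
  have h := lintegral_iterKernel_le (V := fun x => ENNReal.ofReal (V x)) (B := ENNReal.ofReal B)
    hV.ennreal_ofReal (fun P hP x => by
      rw [← ofReal_integral_eq_lintegral_ofReal (hint P hP x) (Eventually.of_forall hV0),
        ← ENNReal.ofReal_mul hB]
      exact ENNReal.ofReal_le_ofReal (hgrow P hP x)) hP n x
  rw [← ENNReal.ofReal_pow hB, ← ENNReal.ofReal_mul (pow_nonneg hB n)] at h
  have hi : Integrable V (iterKernel P n x) :=
    (lintegral_ofReal_ne_top_iff_integrable hV.aestronglyMeasurable (Eventually.of_forall hV0)).1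
      (h.trans_lt ENNReal.ofReal_lt_top).ne
  refine ⟨hi, ?_⟩
  rw [← ofReal_integral_eq_lintegral_ofReal hi (Eventually.of_forall hV0)] at h
  exact (ENNReal.ofReal_le_ofReal_iff (mul_nonneg (pow_nonneg hB n) (hV0 x))).1 h

theorem sum_weighted_abs_iterKernel_sub_le {X : Type*} [MeasurableSpace X]
    {PP : Set (Kernel X X)} {V : X → ℝ} (hV : Measurable V) (hV0 : ∀ x, 0 ≤ V x)
    {q B c a₀ δ κ M : ℝ} (hq0 : 0 < q) (hq1 : q ≤ 1) (hB : 0 ≤ B) (hc : 0 ≤ c) (ha₀ : 0 ≤ a₀)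
    (hκ : 0 ≤ κ)
    (hint : ∀ P ∈ PP, ∀ x, Integrable V (P x))
    (hgrow : ∀ P ∈ PP, ∀ x, ∫ y, V y ∂(P x) ≤ B * V x)
    (hpair : ∀ P ∈ PP, ∀ x x' : X, ∃ (Q : Measure (X × X)) (θ : Measure X), IsFiniteMeasure Q ∧
      IsUncoupling Q θ (P x) (P x') ∧
        ∀ a, a₀ ≤ a → ∫ z, (a + c + (V z.1 + V z.2) ^ q) ^ q⁻¹ ∂Q ≤
          (a + (V x + V x') ^ q) ^ q⁻¹ - δ * (a + (V x + V x') ^ q) ^ (q⁻¹ - 1))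
    {f : X → ℝ} (hf : Measurable f) (hfV : ∀ x, |f x| ≤ M * V x) {w : ℕ → ℝ} (hw : ∀ n, 0 ≤ w n)
    (hwf : ∀ (m : ℕ) (x x' : X), w m * |f x - f x'| ≤
      κ * (δ * (a₀ + c * m + (V x + V x') ^ q) ^ (q⁻¹ - 1)))
    (N : ℕ) {P : ℕ → Kernel X X} (hP : ∀ k, 1 ≤ k → P k ∈ PP) (m : ℕ) (x x' : X) :
    ∑ n ∈ Finset.range N, w (m + n) *
        |(∫ y, f y ∂(iterKernel P n x)) - ∫ y, f y ∂(iterKernel P n x')| ≤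
      κ * (a₀ + c * m + (V x + V x') ^ q) ^ q⁻¹ := by
  induction N generalizing P m x x' with
  | zero =>
    have := hV0 x
    have := hV0 x'
    simp only [Finset.range_zero, Finset.sum_empty]
    positivity
  | succ N ih =>
    obtain ⟨Q, θ, hQfin, hQ, hQle⟩ := hpair (P 1) (hP 1 le_rfl) x x'
    have hP' : ∀ k, 1 ≤ k → P (k + 1) ∈ PP := fun k _ => hP _ k.succ_pos
    obtain ⟨h, hh⟩ : ∃ h : ℕ → X → ℝ,
        h = fun n y => ∫ z, f z ∂(iterKernel (fun k => P (k + 1)) n y) := ⟨_, rfl⟩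
    have hfi : ∀ {P : ℕ → Kernel X X}, (∀ k, 1 ≤ k → P k ∈ PP) → ∀ n y,
        Integrable f (iterKernel P n y) := fun hP n y =>
      ((integrable_iterKernel hV hV0 hB hint hgrow hP n y).1.const_mul M).mono'
        hf.aestronglyMeasurable (Eventually.of_forall hfV)
    have hhi : ∀ n y, Integrable (h n) (P 1 y) := by
      intro n y
      refine ((hint _ (hP 1 le_rfl) y).const_mul (|M| * B ^ n)).mono' ?_
        (Eventually.of_forall fun z => ?_)
      · rw [hh]
        exact hf.stronglyMeasurable.integral_kernel.aestronglyMeasurable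
      · obtain ⟨hi, hle⟩ := integrable_iterKernel hV hV0 hB hint hgrow hP' n z
        rw [hh]
        calc ‖∫ y, f y ∂(iterKernel (fun k => P (k + 1)) n z)‖
            ≤ ∫ y, |M| * V y ∂(iterKernel (fun k => P (k + 1)) n z) :=
              norm_integral_le_of_norm_le (hi.const_mul _) (Eventually.of_forall fun y =>
                (hfV y).trans (mul_le_mul_of_nonneg_right (le_abs_self M) (hV0 y)))
          _ = |M| * ∫ y, V y ∂(iterKernel (fun k => P (k + 1)) n z) := integral_const_mul _ _
          _ ≤ |M| * (B ^ n * V z) := by gcongr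
          _ = |M| * B ^ n * V z := by ring
    have hcomp : ∀ n y, ∫ z, f z ∂(iterKernel P (n + 1) y) = ∫ z, h n z ∂(P 1 y) := by
      intro n y
      have hi := hfi hP (n + 1) y
      rw [iterKernel_succ_eq_comp] at hi ⊢
      rw [Kernel.integral_comp hi, hh]
    have hdi : ∀ n, Integrable (fun z : X × X => w (m + 1 + n) * |h n z.1 - h n z.2|) Q := fun n =>
      (((hQ.integrable_fst (hhi n x)).sub (hQ.integrable_snd (hhi n x'))).abs).const_mul _
    have hcast : a₀ + c * ((m + 1 : ℕ) : ℝ) = a₀ + c * m + c := by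
      push_cast
      ring
    have hWi : Integrable (fun z : X × X =>
        κ * (a₀ + c * m + c + (V z.1 + V z.2) ^ q) ^ q⁻¹) Q :=
      (integrable_add_rpow_rpow_inv (by fun_prop) (fun z => add_nonneg (hV0 _) (hV0 _))
        ((hQ.integrable_fst (hint _ (hP 1 le_rfl) x)).add
          (hQ.integrable_snd (hint _ (hP 1 le_rfl) x'))) hq0 hq1 (by positivity)).const_mul κ
    rw [Finset.sum_range_succ']
    have hzero : w (m + 0) * |(∫ y, f y ∂(iterKernel P 0 x)) - ∫ y, f y ∂(iterKernel P 0 x')| ≤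
        κ * (δ * (a₀ + c * m + (V x + V x') ^ q) ^ (q⁻¹ - 1)) := by
      simp only [iterKernel, Kernel.id_apply, integral_dirac' f _ hf.stronglyMeasurable]
      exact hwf m x x'
    have htail : ∑ n ∈ Finset.range N, w (m + (n + 1)) *
        |(∫ y, f y ∂(iterKernel P (n + 1) x)) - ∫ y, f y ∂(iterKernel P (n + 1) x')| ≤
        κ * ∫ z, (a₀ + c * m + c + (V z.1 + V z.2) ^ q) ^ q⁻¹ ∂Q := by
      calc _ ≤ ∑ n ∈ Finset.range N, ∫ z, w (m + 1 + n) * |h n z.1 - h n z.2| ∂Q := by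
            refine Finset.sum_le_sum fun n _ => ?_
            rw [hcomp, hcomp, ← hQ.integral_sub (hhi n x) (hhi n x'), integral_const_mul,
              show m + (n + 1) = m + 1 + n by ring]
            exact mul_le_mul_of_nonneg_left abs_integral_le_integral_abs (hw _)
        _ = ∫ z, ∑ n ∈ Finset.range N, w (m + 1 + n) * |h n z.1 - h n z.2| ∂Q :=
            (integral_finsetSum _ fun n _ => hdi n).symm
        _ ≤ ∫ z, κ * (a₀ + c * m + c + (V z.1 + V z.2) ^ q) ^ q⁻¹ ∂Q := by
            refine integral_mono (integrable_finsetSum _ fun n _ => hdi n) hWi fun z => ?_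
            have := ih hP' (m + 1) z.1 z.2
            rw [hcast] at this
            rw [hh]
            exact this
        _ = _ := integral_const_mul _ _
    have hdrift := mul_le_mul_of_nonneg_left
      (hQle (a₀ + c * m) (le_add_of_nonneg_right (by positivity))) hκ
    calc _ ≤ _ := add_le_add htail hzero
      _ ≤ _ := by linarith

theorem exists_tsum_iterKernel_sub_le {X : Type*} [MeasurableSpace X] {PP : Set (Kernel X X)}
    (hPP : ∀ P ∈ PP, IsMarkovKernel P) {V : X → ℝ} (hV : Measurable V) (hV1 : ∀ x, 1 ≤ V x)
    {α β b ξ : ℝ} (hα : α ∈ Set.Ioo (0 : ℝ) 1) (hβ : 0 < β) (hb : 0 ≤ b)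
    (hξ : ξ ∈ Set.Icc (0 : ℝ) 1)
    (hint : ∀ P ∈ PP, ∀ x, Integrable V (P x))
    (hdrift : ∀ P ∈ PP, ∀ x, ∫ y, V y ∂(P x) ≤ V x - β * V x ^ α + b)
    (hsmall : ∀ v : ℝ, ∃ ε : ℝ, 0 < ε ∧ ∃ ν : Kernel X X → Measure X,
      (∀ P ∈ PP, IsProbabilityMeasure (ν P)) ∧
      ∀ P ∈ PP, ∀ x : X, V x ≤ v → ∀ A : Set X, MeasurableSet A →
        ENNReal.ofReal ε * ν P A ≤ P x A) :
    ∃ cst : ℝ, ∀ P : ℕ → Kernel X X, (∀ k, 1 ≤ k → P k ∈ PP) →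
      ∀ f : X → ℝ, Measurable f → ∀ M : ℝ, (∀ x, |f x| ≤ M * V x ^ (α * (1 - ξ))) → ∀ x x' : X,
        ∑' n : ℕ, ENNReal.ofReal ((n + 1 : ℝ) ^ (α * ξ / (1 - α)) *
            |(∫ y, f y ∂(iterKernel P n x)) - ∫ y, f y ∂(iterKernel P n x')|) ≤
          ENNReal.ofReal (cst * M * (V x + V x' - 1)) := by
  obtain ⟨c, a₀, δ, hc, hca, hδ, hpair⟩ := exists_pair_drift hPP hV hV1 hα hβ hb hint hdrift hsmall
  obtain ⟨hα0, hα1⟩ := hα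
  obtain ⟨hξ0, hξ1⟩ := hξ
  obtain ⟨q, hq⟩ : ∃ q, q = 1 - α := ⟨_, rfl⟩
  rw [← hq] at hpair ⊢
  have hq0 : 0 < q := by linarith
  have hq1 : q ≤ 1 := by linarith
  have hV0 : ∀ x, 0 ≤ V x := fun x => by linarith [hV1 x]
  have ha₀ : 0 < a₀ := by linarith
  obtain ⟨e, he⟩ : ∃ e, e = α * ξ / q := ⟨_, rfl⟩
  obtain ⟨s, hs⟩ : ∃ s, s = α * (1 - ξ) := ⟨_, rfl⟩
  have he0 : 0 ≤ e := by rw [he]; positivity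
  have hs0 : 0 ≤ s := by rw [hs]; exact mul_nonneg hα0.le (by linarith)
  have hs1 : s ≤ 1 := by rw [hs]; nlinarith
  have hes : e + s / q = q⁻¹ - 1 := by
    rw [he, hs]
    field_simp
    linarith
  rw [← he, ← hs]
  have hce : 0 < c ^ e := Real.rpow_pos_of_pos hc e
  have hgrow : ∀ P ∈ PP, ∀ x, ∫ y, V y ∂(P x) ≤ (1 + b) * V x := by
    intro P hP x
    have h1 := hdrift P hP x
    have h2 : 0 ≤ β * V x ^ α := mul_nonneg hβ.le (Real.rpow_nonneg (hV0 x) α)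
    nlinarith [hV1 x]
  refine ⟨2 / (c ^ e * δ) * ((a₀ + 1) ^ q⁻¹ * 2), fun P hP f hf M hfM x x' => ?_⟩
  have hM : 0 ≤ M := by
    have h1 := (abs_nonneg _).trans (hfM x)
    exact nonneg_of_mul_nonneg_left h1 (Real.rpow_pos_of_pos (by linarith [hV1 x]) s)
  have hfV : ∀ x, |f x| ≤ M * V x := fun x =>
    (hfM x).trans (mul_le_mul_of_nonneg_left
      ((Real.rpow_le_rpow_of_exponent_le (hV1 x) hs1).trans_eq (Real.rpow_one _)) hM)
  obtain ⟨κ, hκ⟩ : ∃ κ, κ = M * (2 / (c ^ e * δ)) := ⟨_, rfl⟩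
  have hκ0 : 0 ≤ κ := by rw [hκ]; positivity
  have hwf : ∀ (m : ℕ) (x x' : X), (m + 1 : ℝ) ^ e * |f x - f x'| ≤
      κ * (δ * (a₀ + c * m + (V x + V x') ^ q) ^ (q⁻¹ - 1)) := by
    intro m x x'
    have hx := hV0 x
    have hx' := hV0 x'
    obtain ⟨U, hU⟩ : ∃ U, U = V x + V x' := ⟨_, rfl⟩
    have hU0 : 0 ≤ U := by linarith
    have hUq : 0 ≤ U ^ q := Real.rpow_nonneg hU0 q
    rw [← hU]
    obtain ⟨S, hS⟩ : ∃ S, S = a₀ + c * m + U ^ q := ⟨_, rfl⟩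
    have hcm : 0 ≤ c * m := by positivity
    have hS0 : 0 < S := by linarith
    rw [← hS]
    have hfU : |f x - f x'| ≤ 2 * M * U ^ s := by
      have h1 := mul_le_mul_of_nonneg_left
        (Real.rpow_le_rpow hx (by linarith : V x ≤ U) hs0) hM
      have h2 := mul_le_mul_of_nonneg_left
        (Real.rpow_le_rpow hx' (by linarith : V x' ≤ U) hs0) hM
      linarith [abs_sub (f x) (f x'), hfM x, hfM x']
    have hUS : U ^ s ≤ S ^ (s / q) := by
      calc U ^ s = (U ^ q) ^ (s / q) := by
            rw [← Real.rpow_mul hU0, mul_div_cancel₀ _ hq0.ne']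
        _ ≤ S ^ (s / q) := Real.rpow_le_rpow hUq (by linarith) (by positivity)
    have hmS : c ^ e * (m + 1 : ℝ) ^ e ≤ S ^ e := by
      rw [← Real.mul_rpow hc.le (by positivity)]
      exact Real.rpow_le_rpow (by positivity) (by linarith) he0
    calc (m + 1 : ℝ) ^ e * |f x - f x'| ≤ S ^ e / c ^ e * (2 * M * S ^ (s / q)) := by
          refine mul_le_mul ?_ (hfU.trans (by gcongr)) (abs_nonneg _) (by positivity)
          rw [le_div_iff₀ hce]
          linarith
      _ = 2 * M / c ^ e * (S ^ e * S ^ (s / q)) := by ring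
      _ = κ * (δ * S ^ (q⁻¹ - 1)) := by
          rw [← Real.rpow_add hS0, hes, hκ]
          field_simp
  refine ENNReal.tsum_le_of_sum_range_le fun N => ?_
  rw [← ENNReal.ofReal_sum_of_nonneg fun n _ => by positivity]
  refine ENNReal.ofReal_le_ofReal ?_
  have hsum := sum_weighted_abs_iterKernel_sub_le hV hV0 hq0 hq1 (by linarith : 0 ≤ 1 + b) hc.le
    ha₀.le hκ0 hint hgrow hpair hf hfV (w := fun m => (m + 1 : ℝ) ^ e) (fun m => by positivity) hwf
    N hP 0 x x'
  simp only [zero_add, Nat.cast_zero, mul_zero, add_zero] at hsum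
  refine hsum.trans ?_
  have hx := hV1 x
  have hx' := hV1 x'
  have hU1 : 1 ≤ V x + V x' := by linarith
  have hUq1 : 1 ≤ (V x + V x') ^ q := Real.one_le_rpow hU1 hq0.le
  have hW : (a₀ + (V x + V x') ^ q) ^ q⁻¹ ≤ (a₀ + 1) ^ q⁻¹ * (V x + V x') := by
    calc (a₀ + (V x + V x') ^ q) ^ q⁻¹ ≤ ((a₀ + 1) * (V x + V x') ^ q) ^ q⁻¹ :=
          Real.rpow_le_rpow (by linarith) (by nlinarith) (by positivity)
      _ = (a₀ + 1) ^ q⁻¹ * (V x + V x') := by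
          rw [Real.mul_rpow (by linarith) (by linarith),
            Real.rpow_rpow_inv (by linarith) hq0.ne']
  calc κ * (a₀ + (V x + V x') ^ q) ^ q⁻¹ ≤ κ * ((a₀ + 1) ^ q⁻¹ * (2 * (V x + V x' - 1))) := by
        refine mul_le_mul_of_nonneg_left (hW.trans ?_) hκ0
        gcongr
        linarith
    _ = _ := by rw [hκ]; ring

theorem integrable_rpow_of_le_one {X : Type*} [MeasurableSpace X] {μ : Measure X} {V : X → ℝ}
    (hV : Measurable V) (hV1 : ∀ x, 1 ≤ V x) {η : ℝ} (hη1 : η ≤ 1) (hVi : Integrable V μ) :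
    Integrable (fun x => V x ^ η) μ := by
  refine hVi.mono' (hV.pow_const η).aestronglyMeasurable (Eventually.of_forall fun x => ?_)
  have hx := hV1 x
  rw [Real.norm_of_nonneg (Real.rpow_nonneg (by linarith) η)]
  exact (Real.rpow_le_rpow_of_exponent_le hx hη1).trans_eq (Real.rpow_one _)

theorem integral_rpow_le_of_drift {X : Type*} [MeasurableSpace X] {μ : Measure X}
    [IsProbabilityMeasure μ] {V : X → ℝ} (hV : Measurable V) (hV1 : ∀ x, 1 ≤ V x)
    {α β b η : ℝ} (hη0 : 0 ≤ η) (hη1 : η ≤ 1) (hb : 0 ≤ b) (hVi : Integrable V μ) {x : X}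
    (hdrift : ∫ y, V y ∂μ ≤ V x - β * V x ^ α + b) :
    ∫ y, V y ^ η ∂μ ≤ V x ^ η - η * β * V x ^ (η - 1 + α) + b := by
  have hx := hV1 x
  have hx0 : 0 < V x := by linarith
  have hsub : Integrable (fun y => V y - V x) μ := hVi.sub (integrable_const _)
  have hlin : Integrable (fun y => η * V x ^ (η - 1) * (V y - V x)) μ := hsub.const_mul _
  have hpow : V x ^ (η - 1) ≤ 1 := Real.rpow_le_one_of_one_le_of_nonpos hx (by linarith)
  have hpow0 : 0 ≤ V x ^ (η - 1) := Real.rpow_nonneg hx0.le _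
  calc ∫ y, V y ^ η ∂μ ≤ ∫ y, (V x ^ η + η * V x ^ (η - 1) * (V y - V x)) ∂μ :=
        integral_mono (integrable_rpow_of_le_one hV hV1 hη1 hVi) ((integrable_const _).add hlin)
          fun y => rpow_le_tangent hη0 hη1 hx0 (by linarith [hV1 y])
    _ = V x ^ η + η * V x ^ (η - 1) * (∫ y, V y ∂μ - V x) := by
        rw [integral_add (integrable_const _) hlin, integral_const_mul,
          integral_sub hVi (integrable_const _)]
        simp
    _ ≤ V x ^ η + η * V x ^ (η - 1) * (-(β * V x ^ α) + b) := by
        gcongr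
        linarith
    _ = V x ^ η - η * β * V x ^ (η - 1 + α) + η * V x ^ (η - 1) * b := by
        rw [Real.rpow_add hx0]
        ring
    _ ≤ _ := by
        have : η * V x ^ (η - 1) * b ≤ 1 * b :=
          mul_le_mul_of_nonneg_right (mul_le_one₀ hη1 hpow0 hpow) hb
        linarith

/-- Corollary 3.4: uniform polynomial rates under Condition (P),
with a constant uniform over all sequences of kernels from the family. -/
theorem statement6 {X : Type*} [MeasurableSpace X]
    (PP : Set (Kernel X X)) (hPP : ∀ P ∈ PP, IsMarkovKernel P)
    (C : Set X) (hC : MeasurableSet C)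
    (Vh : X → ℝ) (hVh : Measurable Vh) (hVh1 : ∀ x, 1 ≤ Vh x)
    (cVh : ℝ) (hcVh : ∀ x ∈ C, Vh x ≤ cVh)
    (β : ℝ) (hβ : 0 < β) (α : ℝ) (hα : α ∈ Set.Ioo (0:ℝ) 1) (bVh : ℝ)
    (hint : ∀ P ∈ PP, ∀ x : X, Integrable Vh (P x))
    (hdriftout : ∀ P ∈ PP, ∀ x ∉ C, ∫ y, Vh y ∂(P x) ≤ Vh x - β * Vh x ^ α)
    (hdriftin : ∀ P ∈ PP, ∀ x ∈ C, ∫ y, Vh y ∂(P x) ≤ bVh)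
    (hsmall : ∀ v : ℝ, ∃ εv : ℝ, 0 < εv ∧ ∃ νP : Kernel X X → Measure X,
      (∀ P ∈ PP, IsProbabilityMeasure (νP P)) ∧
      ∀ P ∈ PP, ∀ x : X, Vh x ≤ v → ∀ A : Set X, MeasurableSet A →
        ENNReal.ofReal εv * νP P A ≤ P x A)
    (ξ : ℝ) (hξ : ξ ∈ Set.Icc (0:ℝ) 1) (lam : ℝ) (hlam : lam ∈ Set.Ico (0:ℝ) 1) :
    ∃ cst : ℝ,
      ∀ P : ℕ → Kernel X X, (∀ k, 1 ≤ k → P k ∈ PP) →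
      ∀ f : X → ℝ, Measurable f → ∀ Mf : ℝ,
        (∀ x, |f x| ≤ Mf * Vh x ^ (α * (1 - lam) * (1 - ξ))) →
      ∀ x x' : X,
        ∑' n : ℕ, ENNReal.ofReal ((n + 1 : ℝ) ^ (α * (1 - lam) * ξ / (1 - α)) *
            |(∫ y, f y ∂(iterKernel P n x)) - ∫ y, f y ∂(iterKernel P n x')|) ≤
          ENNReal.ofReal (cst * Mf *
            (Vh x ^ (1 - lam * α) + Vh x' ^ (1 - lam * α) - 1)) := by
  obtain ⟨hα0, hα1⟩ := hα
  obtain ⟨hlam0, hlam1⟩ := hlam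
  have hVh0 : ∀ x, 0 ≤ Vh x := fun x => by linarith [hVh1 x]
  obtain ⟨b, hb⟩ : ∃ b, b = |bVh| + β * |cVh| ^ α := ⟨_, rfl⟩
  have hb0 : 0 ≤ b := by rw [hb]; positivity
  have hdrift : ∀ P ∈ PP, ∀ x, ∫ y, Vh y ∂(P x) ≤ Vh x - β * Vh x ^ α + b := by
    intro P hP x
    by_cases hx : x ∈ C
    · have h1 := hdriftin P hP x hx
      have h2 := mul_le_mul_of_nonneg_left (Real.rpow_le_rpow (hVh0 x)
        ((hcVh x hx).trans (le_abs_self cVh)) hα0.le) hβ.le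
      linarith [le_abs_self bVh, hVh0 x]
    · linarith [hdriftout P hP x hx]
  obtain ⟨η, hη⟩ : ∃ η, η = 1 - lam * α := ⟨_, rfl⟩
  have hη0 : 0 < η := by rw [hη]; nlinarith
  have hη1 : η ≤ 1 := by rw [hη]; nlinarith
  have hηα : η * (α * (1 - lam) / η) = α * (1 - lam) := mul_div_cancel₀ _ hη0.ne'
  have hα'0 : 0 < α * (1 - lam) / η := div_pos (mul_pos hα0 (by linarith)) hη0
  have hα'1 : α * (1 - lam) / η < 1 := by
    rw [div_lt_one hη0, hη]
    linarith
  obtain ⟨cst, hcst⟩ := exists_tsum_iterKernel_sub_le hPP (hVh.pow_const η)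
    (fun x => Real.one_le_rpow (hVh1 x) hη0.le) ⟨hα'0, hα'1⟩ (mul_pos hη0 hβ) hb0 hξ
    (fun P hP x => integrable_rpow_of_le_one hVh hVh1 hη1 (hint P hP x))
    (fun P hP x => by
      have := hPP P hP
      rw [← Real.rpow_mul (hVh0 x), hηα, show α * (1 - lam) = η - 1 + α by rw [hη]; ring]
      exact integral_rpow_le_of_drift hVh hVh1 hη0.le hη1 hb0 (hint P hP x) (hdrift P hP x))
    (fun v => by
      obtain ⟨ε, hε, ν, hν, hminor⟩ := hsmall (v ^ η⁻¹)
      refine ⟨ε, hε, ν, hν, fun P hP x hx => hminor P hP x ?_⟩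
      have h := Real.rpow_le_rpow (Real.rpow_nonneg (hVh0 x) η) hx (inv_nonneg.2 hη0.le)
      rwa [Real.rpow_rpow_inv (hVh0 x) hη0.ne'] at h)
  have hexp : α * (1 - lam) / η * ξ / (1 - α * (1 - lam) / η) = α * (1 - lam) * ξ / (1 - α) := by
    have h1 : 1 - α * (1 - lam) / η = (1 - α) / η := by
      rw [eq_div_iff hη0.ne', sub_mul, div_mul_cancel₀ _ hη0.ne', hη]
      ring
    have h2 : 1 - α ≠ 0 := by linarith
    rw [h1]
    field_simp
  refine ⟨cst, fun P hP f hf Mf hfM x x' => ?_⟩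
  have h := hcst P hP f hf Mf (fun y => by
    rw [← Real.rpow_mul (hVh0 y), ← mul_assoc, hηα]
    exact hfM y) x x'
  rwa [hexp, hη] at h
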